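/- arXiv:2102.10887 — 4 statements merged into one kernel-verified Lean document; each statement's English description precedes it below -/
import Mathlib

section
/- Let d ≥ 2, let s, t > 0 and let a, b ∈ ℝ^d. Then the double integral ∫_{ℝ^d} ∫_{ℝ^d} G_d(x,y) · p_s(x−a) · p_t(y−b) dx dy equals the single integral ∫_{ℝ^d} G_d(a,y) · p_{s+t}(y−b) dy (Lemma 1 of the paper, with the heat-semigroup images e^{sΔ}δ_a and e^{tΔ}δ_b of Dirac deltas written as the explicit heat kernels p_s(·−a) and p_t(·−b)). -/
open MeasureTheory Real

/-- Surface area of the `(d-1)`-dimensional unit sphere in `ℝ^d`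
(equal to `d` times the volume of the unit ball). -/
noncomputable def sphereArea (d : ℕ) : ℝ :=
  d * (volume (Metric.ball (0 : EuclideanSpace ℝ (Fin d)) 1)).toReal

/-- The fundamental solution `G_d` of the Laplacian on `ℝ^d` for `d ≥ 2`. -/
noncomputable def fundSol (d : ℕ) (x y : EuclideanSpace ℝ (Fin d)) : ℝ :=
  if d = 2 then (1 / (2 * Real.pi)) * Real.log (dist x y)
  else -(1 / (2 * ((d : ℝ) - 2) * sphereArea d * dist x y ^ (d - 2)))

/-- The heat kernel `p_t(x) = (4πt)^{-d/2} exp(-‖x‖²/(4t))` on `ℝ^d`. -/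
noncomputable def heatKer (d : ℕ) (t : ℝ) (x : EuclideanSpace ℝ (Fin d)) : ℝ :=
  (4 * Real.pi * t) ^ (-(d : ℝ) / 2) * Real.exp (-‖x‖ ^ 2 / (4 * t))

/-- The radial profile of the fundamental solution of the Laplacian. -/
noncomputable def fundProfile (d : ℕ) (r : ℝ) : ℝ :=
  if d = 2 then (1 / (2 * Real.pi)) * Real.log r
  else -(1 / (2 * ((d : ℝ) - 2) * sphereArea d * r ^ (d - 2)))

lemma fundSol_eq_fundProfile (d : ℕ) (x y : EuclideanSpace ℝ (Fin d)) :
    fundSol d x y = fundProfile d (dist x y) := rfl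

lemma measurable_fundProfile (d : ℕ) : Measurable (fundProfile d) := by
  unfold fundProfile
  split_ifs
  · exact Real.measurable_log.const_mul _
  · fun_prop

lemma abs_pow_mul_fundProfile_le (d : ℕ) (hd : 2 ≤ d) :
    ∃ C : ℝ, ∀ r : ℝ, 0 < r → |r ^ (d - 1) * fundProfile d r| ≤ C * (1 + r ^ 2) := by
  rcases eq_or_ne d 2 with rfl | h2
  · refine ⟨1 / (2 * π), fun r hr => ?_⟩
    have hlog : |r * log r| ≤ 1 + r ^ 2 := by
      rw [abs_le]
      have h1 := Real.log_le_sub_one_of_pos hr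
      have h3 := Real.one_sub_inv_le_log_of_pos hr
      have h4 : r * r⁻¹ = 1 := mul_inv_cancel₀ hr.ne'
      constructor
      · nlinarith
      · nlinarith
    have hpi : (0 : ℝ) ≤ 1 / (2 * π) := by positivity
    calc |r ^ (2 - 1) * fundProfile 2 r| = |(1 / (2 * π)) * (r * log r)| := by
          simp only [fundProfile, if_true]; congr 1; ring
      _ = (1 / (2 * π)) * |r * log r| := by rw [abs_mul, abs_of_nonneg hpi]
      _ ≤ _ := by gcongr
  · refine ⟨|1 / (2 * ((d : ℝ) - 2) * sphereArea d)|, fun r hr => ?_⟩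
    have hpow : r ^ (d - 1) = r ^ (d - 2) * r := by
      rw [← pow_succ]; congr 1; omega
    have hne : r ^ (d - 2) ≠ 0 := (pow_pos hr _).ne'
    have heq : r ^ (d - 1) * fundProfile d r
        = -(1 / (2 * ((d : ℝ) - 2) * sphereArea d)) * r := by
      rw [fundProfile, if_neg h2, hpow, one_div, one_div, mul_inv _ (r ^ (d - 2))]
      linear_combination (-(2 * ((d : ℝ) - 2) * sphereArea d)⁻¹ * r) * mul_inv_cancel₀ hne
    rw [heq, abs_mul, abs_neg, abs_of_pos hr]
    gcongr
    nlinarith [sq_nonneg (r - 1)]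

lemma integrable_fundProfile_norm_mul_exp (d : ℕ) (hd : 2 ≤ d) {c : ℝ} (hc : 0 < c) :
    Integrable (fun x : EuclideanSpace ℝ (Fin d) =>
      fundProfile d ‖x‖ * exp (-c * ‖x‖ ^ 2)) := by
  have : Nonempty (Fin d) := ⟨⟨0, by omega⟩⟩
  rw [integrable_fun_norm_addHaar volume (f := fun r => fundProfile d r * exp (-c * r ^ 2))]
  obtain ⟨C, hC⟩ := abs_pow_mul_fundProfile_le d hd
  have h0 : Integrable (fun r : ℝ => C * (exp (-c * r ^ 2) + r ^ 2 * exp (-c * r ^ 2))) := by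
    refine Integrable.const_mul ((integrable_exp_neg_mul_sq hc).add ?_) C
    have := integrable_rpow_mul_exp_neg_mul_sq hc (s := 2) (by norm_num)
    simpa using this
  refine h0.integrableOn.mono' ?_ ?_
  · have := measurable_fundProfile d
    exact Measurable.aestronglyMeasurable (by fun_prop)
  · refine (ae_restrict_iff' measurableSet_Ioi).2 (.of_forall fun r hr => ?_)
    rw [finrank_euclideanSpace_fin, smul_eq_mul, ← mul_assoc, norm_mul, norm_eq_abs,
      norm_eq_abs, abs_exp]
    calc _ ≤ C * (1 + r ^ 2) * exp (-c * r ^ 2) := by gcongr; exact hC r hr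
      _ = _ := by ring

lemma measurable_heatKer (d : ℕ) (t : ℝ) : Measurable (heatKer d t) := by
  unfold heatKer; fun_prop

lemma heatKer_nonneg (d : ℕ) {t : ℝ} (ht : 0 < t) (x : EuclideanSpace ℝ (Fin d)) :
    0 ≤ heatKer d t x := by
  unfold heatKer; positivity

lemma integrable_fundSol_mul_heatKer (d : ℕ) (hd : 2 ≤ d) {t : ℝ} (ht : 0 < t)
    (a b : EuclideanSpace ℝ (Fin d)) :
    Integrable (fun y => fundSol d a y * heatKer d t (y - b)) := by
  have hc : 0 < 1 / (8 * t) := by positivity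
  have h := ((integrable_fundProfile_norm_mul_exp d hd hc).comp_sub_left a).norm.const_mul
    ((4 * π * t) ^ (-(d : ℝ) / 2) * exp (‖a - b‖ ^ 2 / (4 * t)))
  refine h.mono' ?_ (.of_forall fun y => ?_)
  · have h1 := measurable_fundProfile d
    have h2 := measurable_heatKer d t
    simp only [fundSol_eq_fundProfile]
    exact Measurable.aestronglyMeasurable (by fun_prop)
  · have hexp : exp (-‖y - b‖ ^ 2 / (4 * t))
        ≤ exp (‖a - b‖ ^ 2 / (4 * t)) * exp (-(1 / (8 * t)) * ‖a - y‖ ^ 2) := by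
      rw [← exp_add, exp_le_exp]
      have htri : ‖a - y‖ ≤ ‖a - b‖ + ‖y - b‖ := by
        simpa [dist_eq_norm] using dist_triangle_right a y b
      have hsq : ‖a - y‖ ^ 2 ≤ 2 * ‖a - b‖ ^ 2 + 2 * ‖y - b‖ ^ 2 := by
        nlinarith [norm_nonneg (a - y), norm_nonneg (a - b), norm_nonneg (y - b),
          sq_nonneg (‖a - b‖ - ‖y - b‖)]
      have : ‖a - b‖ ^ 2 / (4 * t) + -(1 / (8 * t)) * ‖a - y‖ ^ 2 - -‖y - b‖ ^ 2 / (4 * t)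
          = (2 * ‖a - b‖ ^ 2 + 2 * ‖y - b‖ ^ 2 - ‖a - y‖ ^ 2) / (8 * t) := by
        field_simp; ring
      have : 0 ≤ (2 * ‖a - b‖ ^ 2 + 2 * ‖y - b‖ ^ 2 - ‖a - y‖ ^ 2) / (8 * t) :=
        div_nonneg (by linarith) (by positivity)
      linarith
    have hk : (0 : ℝ) ≤ (4 * π * t) ^ (-(d : ℝ) / 2) := by positivity
    rw [fundSol_eq_fundProfile, dist_eq_norm, norm_mul, norm_mul,
      norm_of_nonneg (heatKer_nonneg d ht _), heatKer, norm_of_nonneg (exp_pos _).le]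
    calc _ ≤ ‖fundProfile d ‖a - y‖‖ * ((4 * π * t) ^ (-(d : ℝ) / 2) *
          (exp (‖a - b‖ ^ 2 / (4 * t)) * exp (-(1 / (8 * t)) * ‖a - y‖ ^ 2))) := by gcongr
      _ = _ := by ring

lemma heatKer_mul_heatKer_add (d : ℕ) {s t : ℝ} (hs : 0 < s) (ht : 0 < t)
    (u w : EuclideanSpace ℝ (Fin d)) :
    heatKer d s u * heatKer d t (w + u) =
      (4 * π * s) ^ (-(d : ℝ) / 2) * (4 * π * t) ^ (-(d : ℝ) / 2)
        * exp (-‖w‖ ^ 2 / (4 * (s + t)))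
        * exp (-((s + t) / (4 * s * t)) * ‖u + (s / (s + t)) • w‖ ^ 2) := by
  have hexp : -‖u‖ ^ 2 / (4 * s) + -‖w + u‖ ^ 2 / (4 * t)
      = -‖w‖ ^ 2 / (4 * (s + t))
        + -((s + t) / (4 * s * t)) * ‖u + (s / (s + t)) • w‖ ^ 2 := by
    rw [norm_add_sq_real, norm_add_sq_real, inner_smul_right, norm_smul, mul_pow,
      norm_eq_abs, sq_abs, real_inner_comm u w]
    have : s + t ≠ 0 := by positivity
    field_simp
    ring
  rw [heatKer, heatKer, mul_assoc _ (exp (-‖w‖ ^ 2 / _)), ← exp_add, ← hexp, exp_add]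
  ring

lemma integrable_heatKer_mul_heatKer_add (d : ℕ) {s t : ℝ} (hs : 0 < s) (ht : 0 < t)
    (w : EuclideanSpace ℝ (Fin d)) :
    Integrable (fun u => heatKer d s u * heatKer d t (w + u)) := by
  simp only [heatKer_mul_heatKer_add d hs ht]
  have hc : 0 < (s + t) / (4 * s * t) := by positivity
  refine Integrable.const_mul ?_ _
  have h : Integrable (fun v : EuclideanSpace ℝ (Fin d) =>
      exp (-((s + t) / (4 * s * t)) * ‖v‖ ^ 2)) := by
    refine .of_integral_ne_zero ?_
    rw [GaussianFourier.integral_rexp_neg_mul_sq_norm hc]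
    positivity
  exact h.comp_add_right _

/-- The semigroup property of the heat kernel. -/
lemma integral_heatKer_mul_heatKer_add (d : ℕ) {s t : ℝ} (hs : 0 < s) (ht : 0 < t)
    (w : EuclideanSpace ℝ (Fin d)) :
    ∫ u, heatKer d s u * heatKer d t (w + u) = heatKer d (s + t) w := by
  simp only [heatKer_mul_heatKer_add d hs ht]
  have hc : 0 < (s + t) / (4 * s * t) := by positivity
  rw [integral_const_mul, integral_add_right_eq_self
    (fun v : EuclideanSpace ℝ (Fin d) => exp (-((s + t) / (4 * s * t)) * ‖v‖ ^ 2)),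
    GaussianFourier.integral_rexp_neg_mul_sq_norm hc, finrank_euclideanSpace_fin, heatKer]
  have hconst : (4 * π * s) ^ (-(d : ℝ) / 2) * (4 * π * t) ^ (-(d : ℝ) / 2)
      * (π / ((s + t) / (4 * s * t))) ^ ((d : ℝ) / 2) = (4 * π * (s + t)) ^ (-(d : ℝ) / 2) := by
    have h : π / ((s + t) / (4 * s * t)) = ((4 * π * (s + t)) / ((4 * π * s) * (4 * π * t)))⁻¹ := by
      field_simp
    rw [h, Real.inv_rpow (by positivity), ← Real.rpow_neg (by positivity), ← neg_div,
      ← Real.mul_rpow (by positivity) (by positivity),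
      ← Real.mul_rpow (by positivity) (by positivity)]
    congr 1
    field_simp
  rw [← hconst]
  ring

/-- Lemma 1: `∫∫ G_d(x,y) p_s(x-a) p_t(y-b) dx dy = ∫ G_d(a,y) p_{s+t}(y-b) dy`. -/
theorem stmt_0 (d : ℕ) (hd : 2 ≤ d) (s t : ℝ) (hs : 0 < s) (ht : 0 < t)
    (a b : EuclideanSpace ℝ (Fin d)) :
    (∫ x : EuclideanSpace ℝ (Fin d), ∫ y : EuclideanSpace ℝ (Fin d),
        fundSol d x y * heatKer d s (x - a) * heatKer d t (y - b))
      = ∫ y : EuclideanSpace ℝ (Fin d), fundSol d a y * heatKer d (s + t) (y - b) := by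
  have hF : Integrable (Function.uncurry fun u z : EuclideanSpace ℝ (Fin d) =>
      fundSol d a z * (heatKer d s u * heatKer d t (z - b + u))) (volume.prod volume) := by
    refine (integrable_prod_iff' ?_).2 ⟨.of_forall fun z => ?_, ?_⟩
    · have h1 := measurable_fundProfile d
      have h2 := measurable_heatKer d t
      have h3 := measurable_heatKer d s
      simp only [fundSol_eq_fundProfile, Function.uncurry_def]
      exact Measurable.aestronglyMeasurable (by fun_prop)
    · exact (integrable_heatKer_mul_heatKer_add d hs ht (z - b)).const_mul (fundSol d a z)
    · refine (integrable_fundSol_mul_heatKer d hd (add_pos hs ht) a b).norm.congr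
        (.of_forall fun z => ?_)
      simp only [Function.uncurry, norm_mul, norm_of_nonneg (heatKer_nonneg d hs _),
        norm_of_nonneg (heatKer_nonneg d ht _), norm_of_nonneg (heatKer_nonneg d (add_pos hs ht) _)]
      rw [integral_const_mul, integral_heatKer_mul_heatKer_add d hs ht]
  calc _ = ∫ u : EuclideanSpace ℝ (Fin d), ∫ y : EuclideanSpace ℝ (Fin d),
        fundSol d (u + a) y * heatKer d s (u + a - a) * heatKer d t (y - b) :=
        (integral_add_right_eq_self (fun x : EuclideanSpace ℝ (Fin d) =>
          ∫ y : EuclideanSpace ℝ (Fin d),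
            fundSol d x y * heatKer d s (x - a) * heatKer d t (y - b)) a).symm
    _ = ∫ u : EuclideanSpace ℝ (Fin d), ∫ z : EuclideanSpace ℝ (Fin d),
        fundSol d a z * (heatKer d s u * heatKer d t (z - b + u)) := by
      refine integral_congr_ae (.of_forall fun u => ?_)
      dsimp only
      rw [← integral_add_right_eq_self _ u]
      refine integral_congr_ae (.of_forall fun z => ?_)
      dsimp only
      rw [fundSol_eq_fundProfile, fundSol_eq_fundProfile, add_comm u a, dist_add_right,
        add_sub_cancel_left, add_sub_right_comm, mul_assoc]
    _ = ∫ z : EuclideanSpace ℝ (Fin d), ∫ u : EuclideanSpace ℝ (Fin d),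
        fundSol d a z * (heatKer d s u * heatKer d t (z - b + u)) := integral_integral_swap hF
    _ = _ := by
      refine integral_congr_ae (.of_forall fun z => ?_)
      dsimp only
      rw [integral_const_mul, integral_heatKer_mul_heatKer_add d hs ht]
end

section
/- Let d ≥ 2 and let a, b ∈ ℝ^d with a ≠ b. Then ∫_{ℝ^d} G_d(a,y) · p_t(y−b) dy tends to G_d(a,b) as t → 0⁺ (the limiting step in the proof of Lemma 3). -/
open MeasureTheory Real

/-- The fundamental solution is dominated by a locally integrable radial function of at most
linear growth. -/
lemma exists_abs_fundSol_le (d : ℕ) (hd : 2 ≤ d) :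
    ∃ C : ℝ, 0 ≤ C ∧ ∀ x y : EuclideanSpace ℝ (Fin d),
      |fundSol d x y| ≤ C * ((dist x y ^ (d - 1))⁻¹ + dist x y + 1) := by
  rcases hd.eq_or_lt with rfl | hd'
  · refine ⟨1 / (2 * Real.pi), by positivity, fun x y => ?_⟩
    have hr : 0 ≤ dist x y := dist_nonneg
    simp only [fundSol, if_true, abs_mul]
    rw [abs_of_nonneg (by positivity : 0 ≤ 1 / (2 * Real.pi))]
    gcongr
    have h1 := Real.log_le_self hr
    have h2 := Real.log_le_self (inv_nonneg.2 hr)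
    rw [Real.log_inv] at h2
    have h3 := inv_nonneg.2 hr
    norm_num
    rw [abs_le]
    constructor <;> linarith
  · refine ⟨|(2 * ((d : ℝ) - 2) * sphereArea d)⁻¹|, abs_nonneg _, fun x y => ?_⟩
    have hr : 0 ≤ dist x y := dist_nonneg
    simp only [fundSol, if_neg hd'.ne', abs_neg, one_div, mul_inv _ (dist x y ^ (d - 2)), abs_mul]
    rw [abs_of_nonneg (by positivity : 0 ≤ (dist x y ^ (d - 2))⁻¹)]
    gcongr
    rcases hr.eq_or_lt with h0 | h0
    · rw [← h0, zero_pow (by omega), zero_pow (by omega)]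
      norm_num
    · rcases le_total (dist x y) 1 with h | h
      · have : (dist x y ^ (d - 2))⁻¹ ≤ (dist x y ^ (d - 1))⁻¹ :=
          inv_anti₀ (by positivity) (pow_le_pow_of_le_one hr h (by omega))
        linarith
      · have h1 : (dist x y ^ (d - 2))⁻¹ ≤ 1 := inv_le_one_of_one_le₀ (one_le_pow₀ h)
        have h2 : 0 ≤ (dist x y ^ (d - 1))⁻¹ := by positivity
        linarith

lemma measurable_fundSol (d : ℕ) (x : EuclideanSpace ℝ (Fin d)) : Measurable (fundSol d x) := by
  unfold fundSol
  split_ifs <;> fun_prop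

lemma continuousAt_fundSol (d : ℕ) {x y : EuclideanSpace ℝ (Fin d)} (h : x ≠ y) :
    ContinuousAt (fundSol d x) y := by
  have h0 : 0 < dist x y := dist_pos.2 h
  have hc : ContinuousAt (fun z => dist x z) y := by fun_prop
  unfold fundSol
  split_ifs with h2
  · exact continuousAt_const.mul (hc.log h0.ne')
  · simp only [one_div, mul_inv _ (dist _ _ ^ _)]
    exact (continuousAt_const.mul ((hc.pow _).inv₀ (pow_ne_zero _ h0.ne'))).neg

lemma integrable_inv_pow_add_mul_gaussian (d : ℕ) (hd : 2 ≤ d) :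
    Integrable (fun x : EuclideanSpace ℝ (Fin d) =>
      ((‖x‖ ^ (d - 1))⁻¹ + ‖x‖ + 1) * Real.exp (-(1 / 2) * ‖x‖ ^ 2)) := by
  have : Nontrivial (EuclideanSpace ℝ (Fin d)) := by
    apply Module.nontrivial_of_finrank_pos (R := ℝ)
    rw [finrank_euclideanSpace_fin]
    omega
  refine (integrable_fun_norm_addHaar volume
    (f := fun r : ℝ => ((r ^ (d - 1))⁻¹ + r + 1) * Real.exp (-(1 / 2) * r ^ 2))).2 ?_
  rw [finrank_euclideanSpace_fin]
  have key (n : ℕ) :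
      IntegrableOn (fun r : ℝ => r ^ n * Real.exp (-(1 / 2) * r ^ 2)) (Set.Ioi 0) := by
    have h := integrableOn_rpow_mul_exp_neg_mul_sq (b := 1 / 2) (by norm_num) (s := (n : ℝ))
      (by linarith [n.cast_nonneg (α := ℝ)])
    simpa only [Real.rpow_natCast] using h
  refine (((key 0).add (key (d - 1 + 1))).add (key (d - 1))).congr_fun (fun r hr => ?_)
    measurableSet_Ioi
  have : r ^ (d - 1) ≠ 0 := pow_ne_zero _ (ne_of_gt hr)
  simp only [Pi.add_apply, smul_eq_mul]
  field_simp
  ring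

lemma integrable_fundSol_mul_gaussian (d : ℕ) (hd : 2 ≤ d) (a b : EuclideanSpace ℝ (Fin d)) :
    Integrable (fun x : EuclideanSpace ℝ (Fin d) =>
      fundSol d a (x + b) * Real.exp (-‖x‖ ^ 2)) := by
  obtain ⟨C, hC, hbound⟩ := exists_abs_fundSol_le d hd
  have hmaj := (((integrable_inv_pow_add_mul_gaussian d hd).comp_sub_right (a - b)).const_mul
    (C * Real.exp (‖a - b‖ ^ 2)))
  refine hmaj.mono' ?_ (ae_of_all _ fun x => ?_)
  · exact (((measurable_fundSol d a).comp (measurable_id.add_const b)).mul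
      (by fun_prop)).aestronglyMeasurable
  · have hdist : dist a (x + b) = ‖x - (a - b)‖ := by
      rw [dist_comm, dist_eq_norm]
      congr 1
      abel
    have hexp : Real.exp (-‖x‖ ^ 2) ≤
        Real.exp (‖a - b‖ ^ 2) * Real.exp (-(1 / 2) * ‖x - (a - b)‖ ^ 2) := by
      rw [← Real.exp_add]
      apply Real.exp_le_exp.2
      have h1 := norm_sub_le x (a - b)
      have h2 : ‖x - (a - b)‖ ^ 2 ≤ (‖x‖ + ‖a - b‖) ^ 2 := by gcongr
      nlinarith [sq_nonneg (‖x‖ - ‖a - b‖)]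
    rw [Real.norm_eq_abs, abs_mul, abs_of_pos (Real.exp_pos _)]
    have hb := hbound a (x + b)
    rw [hdist] at hb
    calc _ ≤ (C * ((‖x - (a - b)‖ ^ (d - 1))⁻¹ + ‖x - (a - b)‖ + 1)) *
          (Real.exp (‖a - b‖ ^ 2) * Real.exp (-(1 / 2) * ‖x - (a - b)‖ ^ 2)) := by
          gcongr
      _ = _ := by ring

/-- Integrals against the rescaled standard Gaussian converge to the value at the origin. -/
lemma tendsto_integral_gaussian_smul (d : ℕ) {g : EuclideanSpace ℝ (Fin d) → ℝ}
    (hg : Integrable g) (hg0 : ContinuousAt g 0) :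
    Filter.Tendsto (fun c : ℝ => ∫ x : EuclideanSpace ℝ (Fin d),
      (c ^ d * (Real.pi ^ (-(d : ℝ) / 2) * Real.exp (-‖c • x‖ ^ 2))) * g x)
      Filter.atTop (nhds (g 0)) := by
  have h := tendsto_integral_comp_smul_smul_of_integrable (μ := volume)
    (φ := fun x : EuclideanSpace ℝ (Fin d) => Real.pi ^ (-(d : ℝ) / 2) * Real.exp (-‖x‖ ^ 2))
    (fun x => by positivity) ?_ ?_ hg hg0
  · simpa only [finrank_euclideanSpace_fin, smul_eq_mul] using h
  · have h := GaussianFourier.integral_rexp_neg_mul_sq_norm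
      (V := EuclideanSpace ℝ (Fin d)) one_pos
    rw [finrank_euclideanSpace_fin, div_one] at h
    simp only [neg_mul, one_mul] at h
    rw [integral_const_mul, h, ← Real.rpow_add Real.pi_pos, neg_div, neg_add_cancel,
      Real.rpow_zero]
  · rw [finrank_euclideanSpace_fin]
    have h := (((tendsto_rpow_abs_mul_exp_neg_mul_sq_cocompact one_pos (d : ℝ)).mono_left
      atTop_le_cocompact).comp (tendsto_norm_cobounded_atTop
        (E := EuclideanSpace ℝ (Fin d)))).const_mul (Real.pi ^ (-(d : ℝ) / 2))
    rw [mul_zero] at h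
    refine h.congr fun x => ?_
    simp only [Function.comp_apply, abs_norm, Real.rpow_natCast, neg_mul, one_mul]
    ring

/-- For `t < 1/4`, the heat kernel splits off a fixed Gaussian factor. -/
lemma heatKer_eq_rescaled_gaussian (d : ℕ) {t : ℝ} (ht : 0 < t) (ht' : t < 1 / 4)
    (x : EuclideanSpace ℝ (Fin d)) :
    heatKer d t x = (1 - 4 * t) ^ (-(d : ℝ) / 2) *
      (√(1 / (4 * t) - 1) ^ d * (Real.pi ^ (-(d : ℝ) / 2) *
        Real.exp (-‖√(1 / (4 * t) - 1) • x‖ ^ 2)) * Real.exp (-‖x‖ ^ 2)) := by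
  have h1 : 0 < 1 - 4 * t := by linarith
  have h2 : 1 / (4 * t) - 1 = (1 - 4 * t) * (4 * t)⁻¹ := by field_simp
  have h3 : 0 < 1 / (4 * t) - 1 := by rw [h2]; positivity
  have hpow : √(1 / (4 * t) - 1) ^ d = (1 - 4 * t) ^ ((d : ℝ) / 2) * (4 * t) ^ (-(d : ℝ) / 2) := by
    rw [Real.sqrt_eq_rpow, ← Real.rpow_natCast, ← Real.rpow_mul h3.le, h2,
      Real.mul_rpow h1.le (by positivity), Real.inv_rpow (by positivity),
      ← Real.rpow_neg (by positivity)]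
    congr 2 <;> ring
  have hcancel : (1 - 4 * t) ^ (-(d : ℝ) / 2) * (1 - 4 * t) ^ ((d : ℝ) / 2) = 1 := by
    rw [← Real.rpow_add h1, neg_div, neg_add_cancel, Real.rpow_zero]
  have hexp : Real.exp (-‖x‖ ^ 2 / (4 * t)) =
      Real.exp (-‖√(1 / (4 * t) - 1) • x‖ ^ 2) * Real.exp (-‖x‖ ^ 2) := by
    rw [← Real.exp_add, norm_smul, mul_pow, Real.norm_eq_abs, sq_abs, Real.sq_sqrt h3.le]
    congr 1
    ring
  rw [heatKer, hexp, hpow, show 4 * Real.pi * t = Real.pi * (4 * t) by ring,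
    Real.mul_rpow Real.pi_pos.le (by positivity)]
  linear_combination -(Real.pi ^ (-(d : ℝ) / 2) * (4 * t) ^ (-(d : ℝ) / 2) *
    (Real.exp (-‖√(1 / (4 * t) - 1) • x‖ ^ 2) * Real.exp (-‖x‖ ^ 2))) * hcancel

lemma tendsto_sqrt_one_div_sub_one :
    Filter.Tendsto (fun t : ℝ => √(1 / (4 * t) - 1)) (nhdsWithin 0 (Set.Ioi 0))
      Filter.atTop := by
  refine Real.tendsto_sqrt_atTop.comp (Filter.tendsto_atTop_add_const_right _ (-1) ?_)
  refine (tendsto_inv_nhdsGT_zero.const_mul_atTop (by norm_num : (0 : ℝ) < 1 / 4)).congr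
    fun t => ?_
  rw [one_div, one_div, mul_inv]

/-- The limiting step in the proof of Lemma 3: for `a ≠ b`,
`∫ G_d(a,y) p_t(y-b) dy → G_d(a,b)` as `t → 0⁺`. -/
theorem stmt_4 (d : ℕ) (hd : 2 ≤ d)
    (a b : EuclideanSpace ℝ (Fin d)) (hab : a ≠ b) :
    Filter.Tendsto
      (fun t : ℝ => ∫ y : EuclideanSpace ℝ (Fin d), fundSol d a y * heatKer d t (y - b))
      (nhdsWithin 0 (Set.Ioi 0)) (nhds (fundSol d a b)) := by
  set g : EuclideanSpace ℝ (Fin d) → ℝ :=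
    fun x => fundSol d a (x + b) * Real.exp (-‖x‖ ^ 2) with hg
  have hcont : ContinuousAt g 0 := by
    refine ContinuousAt.mul ?_ (by fun_prop)
    refine ContinuousAt.comp (g := fundSol d a) ?_ (by fun_prop)
    simpa using continuousAt_fundSol d hab
  have hlim := (tendsto_integral_gaussian_smul d
    (integrable_fundSol_mul_gaussian d hd a b) hcont).comp tendsto_sqrt_one_div_sub_one
  have hfactor : Filter.Tendsto (fun t : ℝ => (1 - 4 * t) ^ (-(d : ℝ) / 2))
      (nhdsWithin 0 (Set.Ioi 0)) (nhds 1) := by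
    have h : ContinuousAt (fun t : ℝ => (1 - 4 * t) ^ (-(d : ℝ) / 2)) 0 :=
      ContinuousAt.rpow_const (by fun_prop) (Or.inl (by norm_num))
    simpa [ContinuousAt] using h.tendsto.mono_left nhdsWithin_le_nhds
  have h := hfactor.mul hlim
  have hval : 1 * g 0 = fundSol d a b := by simp [hg]
  rw [hval] at h
  refine h.congr' ?_
  filter_upwards [Ioo_mem_nhdsGT (by norm_num : (0 : ℝ) < 1 / 4)] with t ht
  rw [← integral_add_right_eq_self _ b, Function.comp_apply, ← integral_const_mul]
  congr 1 with x
  rw [add_sub_cancel_right, heatKer_eq_rescaled_gaussian d ht.1 ht.2]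
  ring
end

section
/- Let d ≥ 2, let D > 0, and let x, y ∈ ℝ^d satisfy 0 < ‖x−y‖ ≤ D. Then for every t ≥ D²/d one has ∫_0^t (4πs)^{−d/2} exp(−‖x−y‖²/(4s)) ds ≥ (4π)^{−d/2} [ (d^{d/2−1}/(2 D^{d−2})) · exp(−d‖x−y‖²/(4D²)) + h_{d,D}(t) ], where h_{d,D}(t) = (e^{−d/4}/(1−d/2)) · (t^{1−d/2} − d^{d/2−1}/D^{d−2}) if d ≠ 2, and h_{d,D}(t) = e^{−1/2} · log(2t/D²) if d = 2 (Lemma 4 of the paper). -/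
open MeasureTheory Real

/-- The function `h_{d,D}(t)` from Lemma 4. -/
noncomputable def hTail (d : ℕ) (D t : ℝ) : ℝ :=
  if d = 2 then Real.exp (-(1:ℝ)/2) * Real.log (2 * t / D ^ 2)
  else (Real.exp (-(d : ℝ)/4) / (1 - (d : ℝ)/2)) *
    (1 / t ^ ((d : ℝ)/2 - 1) - (d : ℝ) ^ ((d : ℝ)/2 - 1) / D ^ ((d : ℝ) - 2))

theorem rpow_neg_mul_exp_neg_div_eq {n a s : ℝ} (hs : 0 < s) :
    s ^ (-n) * exp (-(a / s)) = exp (-(n * log s) - a / s) := by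
  rw [rpow_def_of_pos hs, ← Real.exp_add]
  ring_nf

theorem rpow_neg_mul_exp_neg_div_le {n a s : ℝ} (hn : 0 < n) (ha : 0 < a) (hs : 0 < s) :
    s ^ (-n) * exp (-(a / s)) ≤ exp (-(n * log (a / n)) - n) := by
  rw [rpow_neg_mul_exp_neg_div_eq hs, Real.exp_le_exp]
  have h := mul_le_mul_of_nonneg_left
    (Real.log_le_sub_one_of_pos (show 0 < a / n / s by positivity)) hn.le
  rw [Real.log_div (by positivity) hs.ne'] at h
  have h2 : n * (a / n / s - 1) = a / s - n := by field_simp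
  linarith

/-- The function `s ↦ s ^ (-n) * exp (-a / s)` is antitone from `a / n` on. -/
theorem rpow_neg_mul_exp_neg_div_anti {n a s T : ℝ} (hn : 0 ≤ n) (hs : 0 < s)
    (hsT : s ≤ T) (has : a ≤ n * s) :
    T ^ (-n) * exp (-(a / T)) ≤ s ^ (-n) * exp (-(a / s)) := by
  have hT : 0 < T := hs.trans_le hsT
  rw [rpow_neg_mul_exp_neg_div_eq hs, rpow_neg_mul_exp_neg_div_eq hT, Real.exp_le_exp]
  have h := mul_le_mul_of_nonneg_left
    (Real.log_le_sub_one_of_pos (show 0 < s / T by positivity)) hn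
  rw [Real.log_div hs.ne' hT.ne'] at h
  have h2 : a / s - a / T ≤ n * (1 - s / T) := by
    have h3 : a / s - a / T = a / s * (1 - s / T) := by field_simp
    rw [h3]
    apply mul_le_mul_of_nonneg_right
    · rwa [div_le_iff₀ hs]
    · rw [sub_nonneg, div_le_one hT]; exact hsT
  linarith

theorem intervalIntegrable_rpow_neg_mul_exp_neg_div {n a b c : ℝ} (hn : 0 < n) (ha : 0 < a)
    (hb : 0 ≤ b) (hc : 0 ≤ c) :
    IntervalIntegrable (fun s : ℝ ↦ s ^ (-n) * exp (-(a / s))) volume b c := by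
  refine (intervalIntegrable_const (c := exp (-(n * log (a / n)) - n))).mono_fun
    (by fun_prop : Measurable _).aestronglyMeasurable ?_
  refine (ae_restrict_iff' measurableSet_uIoc).2 (Filter.Eventually.of_forall fun s hs ↦ ?_)
  have hs0 : 0 < s := (le_min hb hc).trans_lt hs.1
  beta_reduce
  rw [norm_of_nonneg (exp_nonneg _), norm_of_nonneg (by positivity)]
  exact rpow_neg_mul_exp_neg_div_le hn ha hs0

/-- A lower bound for the integral of `s ^ (-n) * exp (-a / s)` up to `t`, obtained by
discarding `[0, T / 2]` and using monotonicity on `[T / 2, T]` and on `[T, t]`. -/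
theorem le_integral_rpow_neg_mul_exp_neg_div {n a t T : ℝ} (hn : 0 < n) (ha : 0 < a)
    (hT : 0 < T) (haT : a ≤ n * T / 2) (ht : T ≤ t) :
    T / 2 * (T ^ (-n) * exp (-(a / T))) + exp (-(n / 2)) * ∫ s in T..t, s ^ (-n)
      ≤ ∫ s in (0:ℝ)..t, s ^ (-n) * exp (-(a / s)) := by
  have hI {b c : ℝ} (hb : 0 ≤ b) (hc : 0 ≤ c) :=
    intervalIntegrable_rpow_neg_mul_exp_neg_div hn ha hb hc
  have hT2 : 0 ≤ T / 2 := by positivity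
  have ht0 : 0 ≤ t := hT.le.trans ht
  rw [← intervalIntegral.integral_add_adjacent_intervals (hI le_rfl hT.le) (hI hT.le ht0),
    ← intervalIntegral.integral_add_adjacent_intervals (hI le_rfl hT2) (hI hT2 hT.le)]
  have h1 : 0 ≤ ∫ s in (0:ℝ)..T / 2, s ^ (-n) * exp (-(a / s)) :=
    intervalIntegral.integral_nonneg hT2 fun s hs ↦
      mul_nonneg (rpow_nonneg hs.1 _) (exp_nonneg _)
  have h2 : T / 2 * (T ^ (-n) * exp (-(a / T)))
      ≤ ∫ s in T / 2..T, s ^ (-n) * exp (-(a / s)) := by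
    have h := intervalIntegral.integral_mono_on (half_le_self hT.le)
      (intervalIntegrable_const (c := T ^ (-n) * exp (-(a / T)))) (hI hT2 hT.le)
      fun s hs ↦ rpow_neg_mul_exp_neg_div_anti hn.le ((half_pos hT).trans_le hs.1) hs.2
        (haT.trans (by nlinarith [hs.1]))
    rw [intervalIntegral.integral_const, smul_eq_mul] at h
    linarith
  have h3 : exp (-(n / 2)) * ∫ s in T..t, s ^ (-n)
      ≤ ∫ s in T..t, s ^ (-n) * exp (-(a / s)) := by
    rw [← intervalIntegral.integral_const_mul]
    refine intervalIntegral.integral_mono_on ht ?_ (hI hT.le ht0) fun s hs ↦ ?_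
    · refine (intervalIntegral.intervalIntegrable_rpow (Or.inr ?_)).const_mul _
      exact Set.notMem_uIcc_of_lt hT (hT.trans_le ht)
    · have hs0 : 0 < s := hT.trans_le hs.1
      rw [mul_comm]
      refine mul_le_mul_of_nonneg_left ?_ (by positivity)
      rw [Real.exp_le_exp, neg_le_neg_iff, div_le_iff₀ hs0]
      nlinarith [hs.1]
  linarith

theorem sq_div_rpow {d D : ℝ} (hd : 0 < d) (hD : 0 < D) (n : ℝ) :
    (D ^ 2 / d) ^ (1 - n) = d ^ (n - 1) / D ^ (2 * n - 2) := by
  rw [div_rpow (by positivity) hd.le, ← rpow_natCast, ← rpow_mul hD.le,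
    show n - 1 = -(1 - n) by ring, show 2 * n - 2 = -((2 : ℕ) * (1 - n)) by push_cast; ring,
    rpow_neg hd.le, rpow_neg hD.le]
  field_simp

theorem hTail_eq_integral {d : ℕ} (hd : 2 ≤ d) {D t : ℝ} (hD : 0 < D)
    (ht : D ^ 2 / (d : ℝ) ≤ t) :
    hTail d D t = exp (-((d : ℝ) / 2 / 2)) * ∫ s in D ^ 2 / (d : ℝ)..t, s ^ (-((d : ℝ) / 2)) := by
  have hd0 : (0 : ℝ) < d := by positivity
  have hT : 0 < D ^ 2 / (d : ℝ) := by positivity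
  have ht0 : 0 < t := hT.trans_le ht
  have hmem : (0 : ℝ) ∉ Set.uIcc (D ^ 2 / (d : ℝ)) t := Set.notMem_uIcc_of_lt hT ht0
  unfold hTail
  split_ifs with h2
  · subst h2
    have : ∀ s : ℝ, s ^ (-(((2 : ℕ) : ℝ) / 2)) = s⁻¹ := fun s ↦ by
      rw [← rpow_neg_one]; norm_num
    simp_rw [this]
    rw [integral_inv hmem]
    congr 2
    · norm_num
    · push_cast
      field_simp
  · have hne : (d : ℝ) ≠ 2 := by exact_mod_cast h2
    rw [integral_rpow (Or.inr ⟨fun h ↦ hne (by linarith), hmem⟩),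
      show -((d : ℝ) / 2) + 1 = 1 - (d : ℝ) / 2 by ring, sq_div_rpow hd0 hD,
      show -(d : ℝ) / 4 = -((d : ℝ) / 2 / 2) by ring,
      show 2 * ((d : ℝ) / 2) - 2 = (d : ℝ) - 2 by ring,
      show 1 - (d : ℝ) / 2 = -((d : ℝ) / 2 - 1) by ring, rpow_neg ht0.le]
    ring

theorem integral_heatKer {d : ℕ} {t : ℝ} (ht : 0 ≤ t) (x : EuclideanSpace ℝ (Fin d)) :
    ∫ s in (0:ℝ)..t, heatKer d s x = (4 * Real.pi) ^ (-(d : ℝ) / 2) *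
      ∫ s in (0:ℝ)..t, s ^ (-((d : ℝ) / 2)) * exp (-(‖x‖ ^ 2 / 4 / s)) := by
  rw [← intervalIntegral.integral_const_mul]
  refine intervalIntegral.integral_congr fun s hs ↦ ?_
  rw [Set.uIcc_of_le ht] at hs
  simp only [heatKer]
  rw [mul_rpow (by positivity) hs.1, ← neg_div, ← mul_assoc, div_div, neg_div (4 * s)]

/-- Lemma 4: for `0 < ‖x-y‖ ≤ D` and `t ≥ D²/d`,
`∫_0^t p_s(x-y) ds ≥ (4π)^{-d/2} [ d^{d/2-1}/(2D^{d-2}) · exp(-d‖x-y‖²/(4D²)) + h_{d,D}(t) ]`. -/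
theorem stmt_6 (d : ℕ) (hd : 2 ≤ d) (D : ℝ) (hD : 0 < D)
    (x y : EuclideanSpace ℝ (Fin d)) (hxy : 0 < ‖x - y‖) (hxyD : ‖x - y‖ ≤ D)
    (t : ℝ) (ht : D ^ 2 / (d : ℝ) ≤ t) :
    (∫ s in (0:ℝ)..t, heatKer d s (x - y))
      ≥ (4 * Real.pi) ^ (-(d : ℝ)/2) *
          ((d : ℝ) ^ ((d : ℝ)/2 - 1) / (2 * D ^ ((d : ℝ) - 2)) *
              Real.exp (-(d : ℝ) * ‖x - y‖ ^ 2 / (4 * D ^ 2))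
            + hTail d D t) := by
  have hd0 : (0 : ℝ) < d := by positivity
  have hT : 0 < D ^ 2 / (d : ℝ) := by positivity
  have haT : ‖x - y‖ ^ 2 / 4 ≤ (d : ℝ) / 2 * (D ^ 2 / d) / 2 := by
    have h : (d : ℝ) / 2 * (D ^ 2 / d) / 2 = D ^ 2 / 4 := by field_simp; norm_num
    rw [h]
    gcongr
  have key := le_integral_rpow_neg_mul_exp_neg_div (half_pos hd0)
    (show 0 < ‖x - y‖ ^ 2 / 4 by positivity) hT haT ht
  have hmain : D ^ 2 / (d : ℝ) / 2 * ((D ^ 2 / (d : ℝ)) ^ (-((d : ℝ) / 2)) *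
        exp (-(‖x - y‖ ^ 2 / 4 / (D ^ 2 / d)))) =
      (d : ℝ) ^ ((d : ℝ)/2 - 1) / (2 * D ^ ((d : ℝ) - 2)) *
        exp (-(d : ℝ) * ‖x - y‖ ^ 2 / (4 * D ^ 2)) := by
    have h1 := sq_div_rpow hd0 hD ((d : ℝ) / 2)
    rw [sub_eq_add_neg, rpow_add hT, rpow_one, mul_div_cancel₀ _ two_ne_zero] at h1
    have h2 : -(‖x - y‖ ^ 2 / 4 / (D ^ 2 / d)) = -(d : ℝ) * ‖x - y‖ ^ 2 / (4 * D ^ 2) := by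
      field_simp
    rw [h2, mul_comm 2 (D ^ _), ← div_div (_ ^ _), ← h1]
    ring
  rw [ge_iff_le, integral_heatKer (hT.le.trans ht), hTail_eq_integral hd hD ht, ← hmain]
  gcongr
end

section
/- Let ε > 0, let N ≥ 1, and let x_1, …, x_N ∈ ℝ. Define φ_ℓ(x) := exp(−ε²x²) √(2^ℓ ε^{2ℓ}/ℓ!) x^ℓ for ℓ = 0, 1, …, N−1, and the truncated Gaussian kernel K̂(x,y) := Σ_{ℓ=0}^{N−1} φ_ℓ(x) φ_ℓ(y). Then the determinant of the kernel matrix (K̂(x_i, x_j))_{i,j=1}^N equals (Π_{ℓ=0}^{N−1} 2^ℓ ε^{2ℓ}/ℓ!) · exp(−2ε² Σ_{k=1}^N x_k²) · Π_{1 ≤ i < j ≤ N} (x_j − x_i)²; equivalently, −log(det K̂_{𝒳_N})^{1/2} = C_{ε,N} + ε² Σ_{k=1}^N x_k² + Σ_{1 ≤ i < j ≤ N} log(1/|x_i − x_j|) for a constant C_{ε,N} independent of x_1, …, x_N (the identity underlying the logarithmic energy (eq. 3), Section 3.2). -/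
open Real Finset

/-- The eigenfunction `φ_ℓ(x) = exp(-ε²x²) √(2^ℓ ε^{2ℓ}/ℓ!) x^ℓ` of the expansion of the
one-dimensional Gaussian kernel. -/
noncomputable def gaussEig (ε : ℝ) (ℓ : ℕ) (x : ℝ) : ℝ :=
  Real.exp (-ε ^ 2 * x ^ 2) * Real.sqrt (2 ^ ℓ * ε ^ (2 * ℓ) / (Nat.factorial ℓ)) * x ^ ℓ

/-- The matrix `(φ_ℓ(x_i))_{i,ℓ}` is a rescaled Vandermonde matrix. -/
theorem det_gaussEig (ε : ℝ) {N : ℕ} (x : Fin N → ℝ) :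
    (Matrix.of fun i j : Fin N => gaussEig ε j (x i)).det =
      (∏ i, Real.exp (-ε ^ 2 * x i ^ 2)) *
        ((∏ ℓ : Fin N, Real.sqrt (2 ^ (ℓ : ℕ) * ε ^ (2 * (ℓ : ℕ)) / (Nat.factorial ℓ))) *
          (Matrix.vandermonde x).det) := by
  rw [← Matrix.det_mul_row, ← Matrix.det_mul_column]
  congr 1
  ext i j
  simp [gaussEig, Matrix.vandermonde_apply, mul_assoc]

/-- The kernel matrix of the truncated Gaussian kernel is the Gram matrix of the `φ_ℓ`. -/
theorem det_truncatedKernel_eq_sq (ε : ℝ) {N : ℕ} (x : Fin N → ℝ) :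
    (Matrix.of fun i j : Fin N =>
        ∑ ℓ ∈ Finset.range N, gaussEig ε ℓ (x i) * gaussEig ε ℓ (x j)).det =
      (Matrix.of fun i j : Fin N => gaussEig ε j (x i)).det ^ 2 := by
  conv_rhs =>
    rw [sq]
    enter [2]
    rw [← Matrix.det_transpose]
  rw [← Matrix.det_mul]
  congr 1
  ext i j
  simp [Matrix.mul_apply, Finset.sum_range]

theorem det_vandermonde_eq_prod_filter {N : ℕ} (x : Fin N → ℝ) :
    (Matrix.vandermonde x).det =
      ∏ p ∈ Finset.univ.filter (fun p : Fin N × Fin N => p.1 < p.2), (x p.2 - x p.1) := by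
  rw [Matrix.det_vandermonde, Finset.prod_filter, Fintype.prod_prod_type]
  refine Finset.prod_congr rfl fun i _ => ?_
  rw [← Finset.prod_filter]
  exact Finset.prod_congr (by ext; simp) fun _ _ => rfl

theorem det_truncatedKernel (ε : ℝ) {N : ℕ} (x : Fin N → ℝ) :
    (Matrix.of fun i j : Fin N =>
        ∑ ℓ ∈ Finset.range N, gaussEig ε ℓ (x i) * gaussEig ε ℓ (x j)).det =
      (∏ ℓ ∈ Finset.range N, 2 ^ ℓ * ε ^ (2 * ℓ) / (Nat.factorial ℓ)) *
        Real.exp (-2 * ε ^ 2 * ∑ k, (x k) ^ 2) *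
        ∏ p ∈ Finset.univ.filter (fun p : Fin N × Fin N => p.1 < p.2), (x p.2 - x p.1) ^ 2 := by
  have hexp : (∏ i, Real.exp (-ε ^ 2 * x i ^ 2)) ^ 2 =
      Real.exp (-2 * ε ^ 2 * ∑ k, (x k) ^ 2) := by
    rw [← Real.exp_sum, ← Real.exp_nat_mul, ← Finset.mul_sum]
    congr 1
    push_cast
    ring
  have hsqrt : (∏ ℓ : Fin N,
      Real.sqrt (2 ^ (ℓ : ℕ) * ε ^ (2 * (ℓ : ℕ)) / (Nat.factorial ℓ))) ^ 2 =
      ∏ ℓ ∈ Finset.range N, 2 ^ ℓ * ε ^ (2 * ℓ) / (Nat.factorial ℓ) := by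
    rw [← Finset.prod_pow, Finset.prod_range]
    refine Finset.prod_congr rfl fun ℓ _ => Real.sq_sqrt ?_
    rw [pow_mul]
    positivity
  rw [det_truncatedKernel_eq_sq, det_gaussEig, mul_pow, mul_pow, hexp, hsqrt,
    det_vandermonde_eq_prod_filter, Finset.prod_pow]
  ring

/-- Section 3.2: the determinant of the kernel matrix of the truncated Gaussian kernel
`K̂(x,y) = Σ_{ℓ<N} φ_ℓ(x)φ_ℓ(y)` equals
`(Π_{ℓ<N} 2^ℓ ε^{2ℓ}/ℓ!) · exp(-2ε² Σ_k x_k²) · Π_{i<j} (x_j - x_i)²`; equivalently,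
`-log(det K̂_{𝒳_N})^{1/2} = C_{ε,N} + ε² Σ_k x_k² + Σ_{i<j} log(1/|x_i - x_j|)` for a
constant `C_{ε,N}` independent of the points. -/
theorem stmt_15 (ε : ℝ) (hε : 0 < ε) (N : ℕ) (hN : 1 ≤ N) :
    (∀ x : Fin N → ℝ,
      (Matrix.of fun i j : Fin N =>
          ∑ ℓ ∈ Finset.range N, gaussEig ε ℓ (x i) * gaussEig ε ℓ (x j)).det
        = (∏ ℓ ∈ Finset.range N, 2 ^ ℓ * ε ^ (2 * ℓ) / (Nat.factorial ℓ)) *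
            Real.exp (-2 * ε ^ 2 * ∑ k, (x k) ^ 2) *
            ∏ p ∈ Finset.univ.filter (fun p : Fin N × Fin N => p.1 < p.2),
              (x p.2 - x p.1) ^ 2) ∧
    (∃ C : ℝ, ∀ x : Fin N → ℝ, Function.Injective x →
      -Real.log (Real.sqrt
          (Matrix.of fun i j : Fin N =>
            ∑ ℓ ∈ Finset.range N, gaussEig ε ℓ (x i) * gaussEig ε ℓ (x j)).det)
        = C + ε ^ 2 * ∑ k, (x k) ^ 2 +
            ∑ p ∈ Finset.univ.filter (fun p : Fin N × Fin N => p.1 < p.2),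
              Real.log (1 / |x p.1 - x p.2|)) := by
  refine ⟨det_truncatedKernel ε,
    -Real.log (∏ ℓ ∈ Finset.range N, 2 ^ ℓ * ε ^ (2 * ℓ) / (Nat.factorial ℓ)) / 2,
    fun x hx => ?_⟩
  have hpair : ∀ p ∈ Finset.univ.filter (fun p : Fin N × Fin N => p.1 < p.2),
      (x p.2 - x p.1) ^ 2 ≠ 0 := fun p hp =>
    pow_ne_zero 2 (sub_ne_zero.2 (hx.ne (Finset.mem_filter.1 hp).2.ne'))
  have hconst : (∏ ℓ ∈ Finset.range N, 2 ^ ℓ * ε ^ (2 * ℓ) / (Nat.factorial ℓ)) ≠ 0 :=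
    Finset.prod_ne_zero_iff.2 fun ℓ _ => by positivity
  have hlog : ∀ p : Fin N × Fin N,
      Real.log (1 / |x p.1 - x p.2|) = -(1 / 2) * Real.log ((x p.2 - x p.1) ^ 2) := fun p => by
    rw [one_div, Real.log_inv, Real.log_abs, Real.log_pow, ← Real.log_neg_eq_log, neg_sub]
    push_cast
    ring
  have hnonneg := det_truncatedKernel_eq_sq ε x ▸
    sq_nonneg (Matrix.of fun i j : Fin N => gaussEig ε j (x i)).det
  rw [Real.log_sqrt hnonneg, det_truncatedKernel,
    Real.log_mul (mul_ne_zero hconst (Real.exp_ne_zero _)) (Finset.prod_ne_zero_iff.2 hpair),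
    Real.log_mul hconst (Real.exp_ne_zero _), Real.log_exp, Real.log_prod hpair,
    Finset.sum_congr rfl fun p _ => hlog p, ← Finset.mul_sum]
  ring
end
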